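/- arXiv:1704.04620 — 3 statements merged into one kernel-verified Lean document; each statement's English description precedes it below -/
import Mathlib

section
/- Parallel composition of locative transition systems is commutative up to strong bisimilarity: for every L_A-LTS A, every M_A-LTS B (with L and M disjoint finite label sets) and every partial injection σ from L to M, the σ-parallel composition A ||_σ B is strongly bisimilar to B ||_{σ⁻¹} A, where σ⁻¹ is the inverse partial injection. -/
/-- A partial injection on a type of labels, presented as a total function
together with a distinguished domain and a left inverse on that domain. -/
structure PartialInj (Λ : Type) where
  dom : Set Λ
  toFun : Λ → Λ
  inv : Λ → Λ
  leftInv : ∀ ℓ ∈ dom, inv (toFun ℓ) = ℓ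

/-- The range of a partial injection. -/
def PartialInj.rng {Λ : Type} (σ : PartialInj Λ) : Set Λ := σ.toFun '' σ.dom

/-- The inverse partial injection. -/
def PartialInj.symm {Λ : Type} (σ : PartialInj Λ) : PartialInj Λ where
  dom := σ.rng
  toFun := σ.inv
  inv := σ.toFun
  leftInv := by
    rintro m ⟨ℓ, hℓ, rfl⟩
    rw [σ.leftInv ℓ hℓ]

/-- A finite multiset of located actions is located in the label set `L`
if all of its labels belong to `L`. -/
def LocatedIn {Λ A : Type} (L : Set Λ) (a : Multiset (Λ × A)) : Prop :=
  ∀ p ∈ a, p.1 ∈ L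

/-- A finite multiset `d` of located actions is `σ`-dual when it consists of pairs
`(ℓᵢ, aᵢ)` with `ℓᵢ ∈ dom σ` together with the matching pairs `(σ ℓᵢ, dual aᵢ)`. -/
def SigmaDual {Λ A : Type} (dual : A → A) (σ : PartialInj Λ)
    (d : Multiset (Λ × A)) : Prop :=
  ∃ m : Multiset (Λ × A), (∀ p ∈ m, p.1 ∈ σ.dom) ∧
    d = m + m.map (fun p => (σ.toFun p.1, dual p.2))

/-- A locative transition system over labels `Λ` and actions `A`:
a set of states, an initial state, and a transition relation whose labels
are finite multisets of located actions. -/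
structure LTS (Λ A : Type) where
  S : Type
  init : S
  Tr : S → Multiset (Λ × A) → S → Prop

/-- The `σ`-parallel composition of an `L_A`-LTS `𝒜` and an `M_A`-LTS `ℬ`. -/
def parComp {Λ A : Type} (dual : A → A) (σ : PartialInj Λ) (L M : Set Λ)
    (𝒜 ℬ : LTS Λ A) : LTS Λ A where
  S := 𝒜.S × ℬ.S
  init := (𝒜.init, ℬ.init)
  Tr := fun u a t =>
    (LocatedIn (L \ σ.dom) a ∧ 𝒜.Tr u.1 a t.1 ∧ u.2 = t.2) ∨
    (LocatedIn (M \ σ.rng) a ∧ ℬ.Tr u.2 a t.2 ∧ u.1 = t.1) ∨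
    (∃ d b c, SigmaDual dual σ d ∧ 𝒜.Tr u.1 b t.1 ∧ ℬ.Tr u.2 c t.2 ∧
      a + d = b + c)

/-- (Strong) bisimulations between two locative transition systems. -/
def IsBisim {Λ A : Type} (𝒜 ℬ : LTS Λ A) (R : 𝒜.S → ℬ.S → Prop) : Prop :=
  R 𝒜.init ℬ.init ∧
  (∀ u t a v, R u t → 𝒜.Tr u a v → ∃ w, ℬ.Tr t a w ∧ R v w) ∧
  (∀ u t a w, R u t → ℬ.Tr t a w → ∃ v, 𝒜.Tr u a v ∧ R v w)

/-- Strong bisimilarity. -/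
def Bisimilar {Λ A : Type} (𝒜 ℬ : LTS Λ A) : Prop := ∃ R, IsBisim 𝒜 ℬ R

/-- Reflexive-transitive closure of silent (empty-multiset-labelled) transitions. -/
def SilentStar {Λ A : Type} (𝒜 : LTS Λ A) : 𝒜.S → 𝒜.S → Prop :=
  Relation.ReflTransGen (fun u v => 𝒜.Tr u 0 v)

/-- The weak transition relation. -/
def WeakTr {Λ A : Type} (𝒜 : LTS Λ A) (u : 𝒜.S) (a : Multiset (Λ × A))
    (v : 𝒜.S) : Prop :=
  (a = 0 ∧ SilentStar 𝒜 u v) ∨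
    (a ≠ 0 ∧ ∃ x y, SilentStar 𝒜 u x ∧ 𝒜.Tr x a y ∧ SilentStar 𝒜 y v)

/-- Weak bisimulations between two locative transition systems. -/
def IsWeakBisim {Λ A : Type} (𝒜 ℬ : LTS Λ A) (R : 𝒜.S → ℬ.S → Prop) : Prop :=
  R 𝒜.init ℬ.init ∧
  (∀ u t a v, R u t → 𝒜.Tr u a v → ∃ w, WeakTr ℬ t a w ∧ R v w) ∧
  (∀ u t a w, R u t → ℬ.Tr t a w → ∃ v, WeakTr 𝒜 u a v ∧ R v w)

/-- Weak bisimilarity. -/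
def WeakBisimilar {Λ A : Type} (𝒜 ℬ : LTS Λ A) : Prop := ∃ R, IsWeakBisim 𝒜 ℬ R

/-- Weak simulations of `𝒜` by `ℬ`. -/
def IsWeakSim {Λ A : Type} (𝒜 ℬ : LTS Λ A) (R : 𝒜.S → ℬ.S → Prop) : Prop :=
  R 𝒜.init ℬ.init ∧
  (∀ u t a v, R u t → 𝒜.Tr u a v → ∃ w, WeakTr ℬ t a w ∧ R v w)

/-- Weak similarity: `𝒜` is weakly simulated by `ℬ`. -/
def WeakSimilar {Λ A : Type} (𝒜 ℬ : LTS Λ A) : Prop := ∃ R, IsWeakSim 𝒜 ℬ R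

theorem PartialInj.rng_symm {Λ : Type} (σ : PartialInj Λ) : σ.symm.rng = σ.dom := by
  ext ℓ
  constructor
  · rintro ⟨_, ⟨k, hk, rfl⟩, rfl⟩
    change σ.inv (σ.toFun k) ∈ σ.dom
    rwa [σ.leftInv k hk]
  · exact fun hℓ => ⟨σ.toFun ℓ, ⟨ℓ, hℓ, rfl⟩, σ.leftInv ℓ hℓ⟩

theorem PartialInj.symm_symm {Λ : Type} (σ : PartialInj Λ) : σ.symm.symm = σ := by
  cases σ with
  | mk dom toFun inv leftInv =>
    have h := PartialInj.rng_symm ⟨dom, toFun, inv, leftInv⟩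
    simp only [PartialInj.symm] at h ⊢
    simp only [h]

theorem SigmaDual.symm {Λ A : Type} {dual : A → A} (hdual : ∀ a, dual (dual a) = a)
    {σ : PartialInj Λ} {d : Multiset (Λ × A)} (h : SigmaDual dual σ d) :
    SigmaDual dual σ.symm d := by
  obtain ⟨m, hm, rfl⟩ := h
  refine ⟨m.map fun p => (σ.toFun p.1, dual p.2), fun p hp => ?_, ?_⟩
  · obtain ⟨q, hq, rfl⟩ := Multiset.mem_map.1 hp
    exact ⟨q.1, hm q hq, rfl⟩
  · rw [Multiset.map_map, add_comm]
    congr 1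
    conv_lhs => rw [← Multiset.map_id m]
    refine Multiset.map_congr rfl fun p hp => ?_
    exact Prod.ext (σ.leftInv p.1 (hm p hp)).symm (hdual p.2).symm

/-- Swapping the components of a state turns transitions of `𝒜 ||_σ ℬ` into transitions of
`ℬ ||_{σ⁻¹} 𝒜`. -/
theorem parComp_tr_swap {Λ A : Type} {dual : A → A} (hdual : ∀ a, dual (dual a) = a)
    {σ : PartialInj Λ} {L M : Set Λ} {𝒜 ℬ : LTS Λ A} {u v : 𝒜.S × ℬ.S}
    {a : Multiset (Λ × A)} (h : (parComp dual σ L M 𝒜 ℬ).Tr u a v) :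
    (parComp dual σ.symm M L ℬ 𝒜).Tr u.swap a v.swap := by
  rcases h with h | h | ⟨d, b, c, hd, hb, hc, habc⟩
  · exact Or.inr (Or.inl (σ.rng_symm.symm ▸ h))
  · exact Or.inl h
  · exact Or.inr (Or.inr ⟨d, c, b, hd.symm hdual, hc, hb, habc.trans (add_comm b c)⟩)

/-- Parallel composition of locative transition systems is commutative
up to strong bisimilarity: `𝒜 ||_σ ℬ ∼ ℬ ||_{σ⁻¹} 𝒜`. -/
theorem parComp_comm_bisimilar {Λ A : Type} (dual : A → A)
    (hdual : ∀ a, dual (dual a) = a)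
    (L M : Set Λ) (hLfin : L.Finite) (hMfin : M.Finite) (hLM : Disjoint L M)
    (σ : PartialInj Λ) (hdom : σ.dom ⊆ L) (hrng : σ.rng ⊆ M)
    (𝒜 ℬ : LTS Λ A)
    (h𝒜 : ∀ u a v, 𝒜.Tr u a v → LocatedIn L a)
    (hℬ : ∀ u a v, ℬ.Tr u a v → LocatedIn M a) :
    Bisimilar (parComp dual σ L M 𝒜 ℬ) (parComp dual σ.symm M L ℬ 𝒜) := by
  refine ⟨fun u t => t = u.swap, rfl, ?_, ?_⟩
  · rintro u _ a v rfl h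
    exact ⟨v.swap, parComp_tr_swap hdual h, rfl⟩
  · rintro u _ a w rfl h
    refine ⟨w.swap, ?_, w.swap_swap.symm⟩
    have h' := parComp_tr_swap hdual h
    rwa [σ.symm_symm] at h'
end

section
/- Strong bisimilarity is a congruence for parallel composition of locative transition systems: for all L_A-LTSs A and B, every M_A-LTS C (with L and M disjoint finite label sets) and every partial injection σ from L to M, if A ∼ B then A ||_σ C ∼ B ||_σ C. -/
/-- A simulation clause between two systems lifts to their parallel compositions with a
common right component, relating states whose right components are equal. -/
theorem parComp_transfer {Λ A : Type} (dual : A → A) (σ : PartialInj Λ) (L M : Set Λ)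
    (𝒜 ℬ 𝒞 : LTS Λ A) (R : 𝒜.S → ℬ.S → Prop)
    (hsim : ∀ u t a v, R u t → 𝒜.Tr u a v → ∃ w, ℬ.Tr t a w ∧ R v w)
    (u v : 𝒜.S × 𝒞.S) (t : ℬ.S × 𝒞.S) (a : Multiset (Λ × A))
    (hR : R u.1 t.1) (heq : u.2 = t.2) (htr : (parComp dual σ L M 𝒜 𝒞).Tr u a v) :
    ∃ w : ℬ.S × 𝒞.S, (parComp dual σ L M ℬ 𝒞).Tr t a w ∧ R v.1 w.1 ∧ v.2 = w.2 := by
  rcases htr with ⟨ha, h, hc⟩ | ⟨ha, h, hc⟩ | ⟨d, b, c, hd, hb, hc, hsum⟩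
  · obtain ⟨w, hw, hvw⟩ := hsim _ _ _ _ hR h
    exact ⟨(w, t.2), Or.inl ⟨ha, hw, rfl⟩, hvw, hc.symm.trans heq⟩
  · exact ⟨(t.1, v.2), Or.inr (Or.inl ⟨ha, heq ▸ h, rfl⟩), hc ▸ hR, rfl⟩
  · obtain ⟨w, hw, hvw⟩ := hsim _ _ _ _ hR hb
    exact ⟨(w, v.2), Or.inr (Or.inr ⟨d, b, c, hd, hw, heq ▸ hc, hsum⟩), hvw, rfl⟩

/-- Strong bisimilarity is a congruence for parallel composition:
if `𝒜 ∼ ℬ` then `𝒜 ||_σ 𝒞 ∼ ℬ ||_σ 𝒞`. -/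
theorem bisimilar_parComp_congr {Λ A : Type} (dual : A → A)
    (hdual : ∀ a, dual (dual a) = a)
    (L M : Set Λ) (hLfin : L.Finite) (hMfin : M.Finite) (hLM : Disjoint L M)
    (σ : PartialInj Λ) (hdom : σ.dom ⊆ L) (hrng : σ.rng ⊆ M)
    (𝒜 ℬ 𝒞 : LTS Λ A)
    (h𝒜 : ∀ u a v, 𝒜.Tr u a v → LocatedIn L a)
    (hℬ : ∀ u a v, ℬ.Tr u a v → LocatedIn L a)
    (h𝒞 : ∀ u a v, 𝒞.Tr u a v → LocatedIn M a)
    (hbisim : Bisimilar 𝒜 ℬ) :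
    Bisimilar (parComp dual σ L M 𝒜 𝒞) (parComp dual σ L M ℬ 𝒞) := by
  obtain ⟨R, hinit, hforth, hback⟩ := hbisim
  refine ⟨fun u t => R u.1 t.1 ∧ u.2 = t.2, ⟨hinit, rfl⟩, ?_, ?_⟩
  · rintro u t a v ⟨hR, heq⟩ htr
    exact parComp_transfer dual σ L M 𝒜 ℬ 𝒞 R hforth u v t a hR heq htr
  · rintro u t a w ⟨hR, heq⟩ htr
    obtain ⟨v, hv, hvw, hc⟩ := parComp_transfer dual σ L M ℬ 𝒜 𝒞 (fun x y => R y x)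
      (fun x y b z hxy hx => hback y x b z hxy hx) t w u a hR heq.symm htr
    exact ⟨v, hv, hvw, hc.symm⟩
end

section
/- Strong bisimilarity is also a congruence for parallel composition on the right: for every L_A-LTS C, all M_A-LTSs A and B (with L and M disjoint finite label sets) and every partial injection σ from L to M, if A ∼ B then C ||_σ A ∼ C ||_σ B. -/
/-- Strong bisimilarity is a congruence for parallel composition on the right:
if `𝒜 ∼ ℬ` then `𝒞 ||_σ 𝒜 ∼ 𝒞 ||_σ ℬ`. -/
theorem bisimilar_parComp_congr_right {Λ A : Type} (dual : A → A)
    (hdual : ∀ a, dual (dual a) = a)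
    (L M : Set Λ) (hLfin : L.Finite) (hMfin : M.Finite) (hLM : Disjoint L M)
    (σ : PartialInj Λ) (hdom : σ.dom ⊆ L) (hrng : σ.rng ⊆ M)
    (𝒜 ℬ 𝒞 : LTS Λ A)
    (h𝒜 : ∀ u a v, 𝒜.Tr u a v → LocatedIn M a)
    (hℬ : ∀ u a v, ℬ.Tr u a v → LocatedIn M a)
    (h𝒞 : ∀ u a v, 𝒞.Tr u a v → LocatedIn L a)
    (hbisim : Bisimilar 𝒜 ℬ) :
    Bisimilar (parComp dual σ L M 𝒞 𝒜) (parComp dual σ L M 𝒞 ℬ) := by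
  obtain ⟨R, hinit, hforth, hback⟩ := hbisim
  refine ⟨fun p q => p.1 = q.1 ∧ R p.2 q.2, ⟨rfl, hinit⟩, ?_, ?_⟩
  · rintro ⟨x, u⟩ ⟨_, t⟩ a ⟨y, v⟩ ⟨rfl, hR⟩
      (⟨hloc, hC, rfl⟩ | ⟨hloc, hA, rfl⟩ | ⟨d, b, c, hd, hC, hA, hsum⟩)
    · exact ⟨(y, t), .inl ⟨hloc, hC, rfl⟩, rfl, hR⟩
    · obtain ⟨w, hB, hR'⟩ := hforth _ _ _ _ hR hA
      exact ⟨(x, w), .inr (.inl ⟨hloc, hB, rfl⟩), rfl, hR'⟩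
    · obtain ⟨w, hB, hR'⟩ := hforth _ _ _ _ hR hA
      exact ⟨(y, w), .inr (.inr ⟨d, b, c, hd, hC, hB, hsum⟩), rfl, hR'⟩
  · rintro ⟨x, u⟩ ⟨_, t⟩ a ⟨y, w⟩ ⟨rfl, hR⟩
      (⟨hloc, hC, rfl⟩ | ⟨hloc, hB, rfl⟩ | ⟨d, b, c, hd, hC, hB, hsum⟩)
    · exact ⟨(y, u), .inl ⟨hloc, hC, rfl⟩, rfl, hR⟩
    · obtain ⟨v, hA, hR'⟩ := hback _ _ _ _ hR hB
      exact ⟨(x, v), .inr (.inl ⟨hloc, hA, rfl⟩), rfl, hR'⟩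
    · obtain ⟨v, hA, hR'⟩ := hback _ _ _ _ hR hB
      exact ⟨(y, v), .inr (.inr ⟨d, b, c, hd, hC, hA, hsum⟩), rfl, hR'⟩
end
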